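/- Let d ≥ 1 and C ≥ 1, let a_1, …, a_C ∈ ℝᵈ and b_1, …, b_C ∈ ℝ, and for z ∈ ℝᵈ define the softmax probability p(z)_i = exp(a_i·z + b_i) / Σ_{j=1}^C exp(a_j·z + b_j). Let μ ∈ ℝᵈ, σ ∈ ℝᵈ with σ_k ≥ 0, and let Z be a random vector in ℝᵈ distributed according to the product measure ⊗_{k=1}^d N(μ_k, σ_k²), with covariance matrix Σ = diag(σ₁²,…,σ_d²). Then for every class index i, the random variable log p(Z)_i is integrable and −E[ log p(Z)_i ] ≤ log Σ_{j=1}^C exp( (a_j − a_i)·μ + (b_j − b_i) + (1/2)(a_j − a_i)Σ(a_j − a_i)ᵀ ), where for u ∈ ℝᵈ we write uΣuᵀ = Σ_{k=1}^d u_k² σ_k². -/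

import Mathlib

open Real BigOperators Finset MeasureTheory ProbabilityTheory

/-- The softmax prediction probability `p(z)_i = exp(a_i·z + b_i) / ∑_j exp(a_j·z + b_j)`. -/
noncomputable def softmax {d C : ℕ} (a : Fin C → Fin d → ℝ) (b : Fin C → ℝ)
    (z : Fin d → ℝ) (i : Fin C) : ℝ :=
  Real.exp ((∑ k, a i k * z k) + b i) / ∑ j, Real.exp ((∑ k, a j k * z k) + b j)

/-- Jensen's inequality for the logarithm of a positive integrable function. -/
lemma integral_log_le_log_integral {Ω : Type*} [MeasurableSpace Ω] {P : Measure Ω}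
    [IsProbabilityMeasure P] {F : Ω → ℝ} (hF : Integrable F P)
    (hlog : Integrable (fun ω => Real.log (F ω)) P) (hpos : ∀ ω, 0 < F ω) :
    ∫ ω, Real.log (F ω) ∂P ≤ Real.log (∫ ω, F ω ∂P) := by
  have hm : 0 < ∫ ω, F ω ∂P := by
    rw [integral_pos_iff_support_of_nonneg (fun ω => (hpos ω).le) hF]
    have : Function.support F = Set.univ := Set.eq_univ_of_forall fun ω => (hpos ω).ne'
    simp [this]
  have hle : ∀ ω, Real.log (F ω) ≤ Real.log (∫ ω, F ω ∂P) + (F ω / (∫ ω, F ω ∂P) - 1) := by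
    intro ω
    have h := Real.log_le_sub_one_of_pos (div_pos (hpos ω) hm)
    rw [Real.log_div (hpos ω).ne' hm.ne'] at h
    linarith
  have hdiv : Integrable (fun ω => F ω / (∫ ω, F ω ∂P) - 1) P :=
    (hF.div_const _).sub (integrable_const _)
  calc ∫ ω, Real.log (F ω) ∂P
      ≤ ∫ ω, (Real.log (∫ ω, F ω ∂P) + (F ω / (∫ ω, F ω ∂P) - 1)) ∂P :=
        integral_mono hlog ((integrable_const _).add hdiv) hle
    _ = Real.log (∫ ω, F ω ∂P) := by
        rw [integral_add (integrable_const _) hdiv,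
          integral_sub (hF.div_const _) (integrable_const _), integral_div, div_self hm.ne']
        simp

lemma integrable_exp_sum_mul_pi_gaussianReal {ι : Type*} [Fintype ι] (u μ : ι → ℝ)
    (v : ι → NNReal) :
    Integrable (fun z : ι → ℝ => Real.exp (∑ k, u k * z k))
      (Measure.pi fun k => gaussianReal (μ k) (v k)) := by
  simp_rw [Real.exp_sum]
  exact Integrable.fintype_prod (f := fun k x => Real.exp (u k * x))
    fun k => integrable_exp_mul_gaussianReal (u k)

/-- The moment generating function of a product of real Gaussian measures. -/
lemma integral_exp_sum_mul_pi_gaussianReal {ι : Type*} [Fintype ι] (u μ : ι → ℝ)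
    (v : ι → NNReal) :
    ∫ z : ι → ℝ, Real.exp (∑ k, u k * z k) ∂(Measure.pi fun k => gaussianReal (μ k) (v k))
      = Real.exp ((∑ k, u k * μ k) + (1 / 2) * ∑ k, u k ^ 2 * v k) := by
  simp_rw [Real.exp_sum]
  rw [integral_fintype_prod_eq_prod (f := fun k x => Real.exp (u k * x)), mul_sum,
    ← sum_add_distrib, Real.exp_sum]
  refine prod_congr rfl fun k _ => ?_
  have h := congrFun (mgf_id_gaussianReal (μ := μ k) (v := v k)) (u k)
  simp only [mgf, id] at h
  rw [h]
  congr 1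
  ring

lemma neg_log_softmax {d C : ℕ} (a : Fin C → Fin d → ℝ) (b : Fin C → ℝ) (z : Fin d → ℝ)
    (i : Fin C) :
    -Real.log (softmax a b z i)
      = Real.log (∑ j, Real.exp (∑ k, (a j k - a i k) * z k) * Real.exp (b j - b i)) := by
  rw [softmax, ← Real.log_inv, inv_div, sum_div]
  congr 1
  refine sum_congr rfl fun j _ => ?_
  rw [← Real.exp_sub, ← Real.exp_add]
  simp only [sub_mul, sum_sub_distrib]
  congr 1
  ring

/-- The bound on the expected negative log-softmax, with the variances given as nonnegative
reals. -/
lemma neg_integral_log_softmax_le {d C : ℕ} (a : Fin C → Fin d → ℝ) (b : Fin C → ℝ)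
    (μ : Fin d → ℝ) (v : Fin d → NNReal) (i : Fin C) :
    Integrable (fun z : Fin d → ℝ => Real.log (softmax a b z i))
        (Measure.pi fun k => gaussianReal (μ k) (v k)) ∧
    -∫ z : Fin d → ℝ, Real.log (softmax a b z i) ∂(Measure.pi fun k => gaussianReal (μ k) (v k))
      ≤ Real.log (∑ j, Real.exp ((∑ k, (a j k - a i k) * μ k) + (b j - b i)
          + (1 / 2) * ∑ k, (a j k - a i k) ^ 2 * v k)) := by
  set P := Measure.pi fun k => gaussianReal (μ k) (v k) with hP
  set F : (Fin d → ℝ) → ℝ := fun z =>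
    ∑ j, Real.exp (∑ k, (a j k - a i k) * z k) * Real.exp (b j - b i) with hF
  have hlogF : ∀ z, Real.log (softmax a b z i) = -Real.log (F z) := fun z => by
    rw [← neg_log_softmax, neg_neg]
  have hterm : ∀ j, Integrable
      (fun z => Real.exp (∑ k, (a j k - a i k) * z k) * Real.exp (b j - b i)) P :=
    fun j => (integrable_exp_sum_mul_pi_gaussianReal _ _ _).mul_const _
  have hFint : Integrable F P := integrable_finsetSum _ fun j _ => hterm j
  have hF_one : ∀ z, 1 ≤ F z := fun z => by
    have h := single_le_sum (f := fun j =>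
      Real.exp (∑ k, (a j k - a i k) * z k) * Real.exp (b j - b i))
      (fun j _ => by positivity) (mem_univ i)
    simpa using h
  have hlog : Integrable (fun z => Real.log (F z)) P := by
    refine hFint.mono' (Real.measurable_log.comp_aemeasurable
      hFint.aemeasurable).aestronglyMeasurable (.of_forall fun z => ?_)
    rw [Real.norm_of_nonneg (Real.log_nonneg (hF_one z))]
    exact Real.log_le_self (zero_le_one.trans (hF_one z))
  simp_rw [hlogF]
  refine ⟨hlog.neg, ?_⟩
  rw [integral_neg, neg_neg]
  refine (integral_log_le_log_integral hFint hlog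
    fun z => zero_lt_one.trans_le (hF_one z)).trans_eq ?_
  rw [hF, integral_finsetSum _ fun j _ => hterm j]
  congr 1
  refine sum_congr rfl fun j _ => ?_
  rw [integral_mul_const, hP, integral_exp_sum_mul_pi_gaussianReal, ← Real.exp_add]
  congr 1
  ring

/-- **Lemma 2 (Upper Bound of Negative Log-Likelihood).**
If `Z ~ ⊗ₖ N(μ k, (σ k)²)` (diagonal covariance `Σ = diag(σ₁², …, σ_d²)`), then
`log p(Z)_i` is integrable and
`−E[log p(Z)_i] ≤ log ∑_j exp((a_j − a_i)·μ + (b_j − b_i) + ½ (a_j − a_i) Σ (a_j − a_i)ᵀ)`. -/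
theorem neg_log_likelihood_upper_bound (d C : ℕ) (hd : 1 ≤ d) (hC : 1 ≤ C)
    (a : Fin C → Fin d → ℝ) (b : Fin C → ℝ)
    (μ σ : Fin d → ℝ) (hσ : ∀ k, 0 ≤ σ k) (i : Fin C) :
    Integrable (fun z : Fin d → ℝ => Real.log (softmax a b z i))
        (Measure.pi fun k => gaussianReal (μ k) ⟨(σ k) ^ 2, sq_nonneg _⟩) ∧
    -∫ z : Fin d → ℝ, Real.log (softmax a b z i)
        ∂(Measure.pi fun k => gaussianReal (μ k) ⟨(σ k) ^ 2, sq_nonneg _⟩)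
      ≤ Real.log (∑ j, Real.exp ((∑ k, (a j k - a i k) * μ k) + (b j - b i)
          + (1 / 2) * ∑ k, (a j k - a i k) ^ 2 * (σ k) ^ 2)) := by
  exact neg_integral_log_softmax_le a b μ (fun k => ⟨σ k ^ 2, sq_nonneg _⟩) i
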